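/- arXiv:2102.10242 — 8 statements merged into one kernel-verified Lean document; each statement's English description precedes it below -/
import Mathlib

section
/- Let Ω be a nonempty finite type, T ≥ 1 a natural number, P : Ω → Ω → ℝ a row-stochastic matrix, level : Ω → ZMod T a level function for P, and d : Ω → ℝ a stationary probability distribution for P. Then for every t : ZMod T, the total mass of d on the level set t+1 equals the total mass of d on the level set t; that is, Σ_{ω : level ω = t+1} d ω = Σ_{ω : level ω = t} d ω. -/
theorem stationary_level_mass_shift {Ω : Type*} [Fintype Ω] [Nonempty Ω]
    (T : ℕ) (hT : 1 ≤ T) (P : Ω → Ω → ℝ)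
    (hPnonneg : ∀ ω ω', 0 ≤ P ω ω') (hProw : ∀ ω, ∑ ω', P ω ω' = 1)
    (level : Ω → ZMod T)
    (hlevel : ∀ ω ω', 0 < P ω ω' → level ω' = level ω + 1)
    (d : Ω → ℝ) (hdnonneg : ∀ ω, 0 ≤ d ω) (hdsum : ∑ ω, d ω = 1)
    (hstat : ∀ ω, d ω = ∑ ω', d ω' * P ω' ω) :
    ∀ t : ZMod T,
      ∑ ω ∈ Finset.univ.filter (fun ω => level ω = t + 1), d ω
        = ∑ ω ∈ Finset.univ.filter (fun ω => level ω = t), d ω := by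
  intro t
  have hrow : ∀ ω', ∑ ω ∈ Finset.univ.filter (fun ω => level ω = t + 1), P ω' ω
      = if level ω' = t then 1 else 0 := by
    intro ω'
    have hzero : ∀ ω, level ω ≠ level ω' + 1 → P ω' ω = 0 := fun ω h =>
      le_antisymm (not_lt.mp fun hpos => h (hlevel ω' ω hpos)) (hPnonneg ω' ω)
    split_ifs with h
    · rw [← hProw ω']
      refine Finset.sum_subset (Finset.filter_subset _ _) fun ω _ hω => hzero ω ?_
      simpa [h] using hω
    · refine Finset.sum_eq_zero fun ω hω => hzero ω fun hω' => h ?_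
      exact add_right_cancel (hω'.symm.trans (Finset.mem_filter.mp hω).2)
  calc ∑ ω ∈ Finset.univ.filter (fun ω => level ω = t + 1), d ω
      = ∑ ω ∈ Finset.univ.filter (fun ω => level ω = t + 1), ∑ ω', d ω' * P ω' ω :=
        Finset.sum_congr rfl fun ω _ => hstat ω
    _ = ∑ ω', d ω' * ∑ ω ∈ Finset.univ.filter (fun ω => level ω = t + 1), P ω' ω := by
        rw [Finset.sum_comm]
        simp only [Finset.mul_sum]
    _ = ∑ ω ∈ Finset.univ.filter (fun ω => level ω = t), d ω := by
        simp only [hrow, mul_ite, mul_one, mul_zero, Finset.sum_filter]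
end

section
/- Let Ω be a nonempty finite type, T ≥ 1 a natural number, P : Ω → Ω → ℝ a row-stochastic matrix, level : Ω → ZMod T a level function for P, and d : Ω → ℝ a stationary probability distribution for P. Then for every t : ZMod T, Σ_{ω : level ω = t} d ω = 1/T; that is, d assigns total mass exactly 1/T to each level set. -/
/-- If every positive transition raises the level by one, then consecutive level sets have the
same mass under a stationary measure. -/
lemma sum_level_add_one_eq_of_stationary {Ω G : Type*} [Fintype Ω] [AddGroupWithOne G]
    [DecidableEq G] {P : Ω → Ω → ℝ}
    (hPnonneg : ∀ ω ω', 0 ≤ P ω ω') (hProw : ∀ ω, ∑ ω', P ω ω' = 1) {level : Ω → G}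
    (hlevel : ∀ ω ω', 0 < P ω ω' → level ω' = level ω + 1)
    {d : Ω → ℝ} (hstat : ∀ ω, d ω = ∑ ω', d ω' * P ω' ω) (t : G) :
    ∑ ω with level ω = t + 1, d ω = ∑ ω with level ω = t, d ω := by
  have zero_of_ne {ω ω' : Ω} (h : level ω' ≠ level ω + 1) : P ω ω' = 0 :=
    ((hPnonneg ω ω').eq_or_lt.resolve_right fun hpos => h (hlevel ω ω' hpos)).symm
  have row (ω : Ω) : ∑ ω' with level ω' = t + 1, P ω ω' = if level ω = t then 1 else 0 := by
    split_ifs with h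
    · subst h
      rw [← hProw ω]
      refine Finset.sum_filter_of_ne fun ω' _ hne => ?_
      by_contra hl
      exact hne (zero_of_ne hl)
    · refine Finset.sum_eq_zero fun ω' hω' => zero_of_ne fun hl => h ?_
      exact (add_right_cancel ((Finset.mem_filter.mp hω').2.symm.trans hl)).symm
  calc ∑ ω with level ω = t + 1, d ω
      = ∑ ω with level ω = t + 1, ∑ ω', d ω' * P ω' ω :=
        Finset.sum_congr rfl fun ω _ => hstat ω
    _ = ∑ ω', d ω' * ∑ ω with level ω = t + 1, P ω' ω := by
        rw [Finset.sum_comm]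
        simp only [Finset.mul_sum]
    _ = ∑ ω with level ω = t, d ω := by
        simp only [row, mul_ite, mul_one, mul_zero, Finset.sum_filter]

/-- A function on `ZMod n` that is invariant under adding one is constant. -/
lemma ZMod.eq_apply_zero_of_add_one {n : ℕ} [NeZero n] {α : Type*} {f : ZMod n → α}
    (hf : ∀ t, f (t + 1) = f t) (t : ZMod n) : f t = f 0 := by
  have key (k : ℕ) : f k = f 0 := by
    induction k with
    | zero => rw [Nat.cast_zero]
    | succ k ih => rw [Nat.cast_succ, hf, ih]
  simpa using key t.val

theorem stationary_level_mass_eq_inv {Ω : Type*} [Fintype Ω] [Nonempty Ω]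
    (T : ℕ) (hT : 1 ≤ T) (P : Ω → Ω → ℝ)
    (hPnonneg : ∀ ω ω', 0 ≤ P ω ω') (hProw : ∀ ω, ∑ ω', P ω ω' = 1)
    (level : Ω → ZMod T)
    (hlevel : ∀ ω ω', 0 < P ω ω' → level ω' = level ω + 1)
    (d : Ω → ℝ) (hdnonneg : ∀ ω, 0 ≤ d ω) (hdsum : ∑ ω, d ω = 1)
    (hstat : ∀ ω, d ω = ∑ ω', d ω' * P ω' ω) :
    ∀ t : ZMod T,
      ∑ ω ∈ Finset.univ.filter (fun ω => level ω = t), d ω = 1 / (T : ℝ) := by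
  intro t
  have : NeZero T := ⟨by omega⟩
  have const (s : ZMod T) : ∑ ω with level ω = s, d ω = ∑ ω with level ω = 0, d ω :=
    ZMod.eq_apply_zero_of_add_one (f := fun s => ∑ ω with level ω = s, d ω)
      (sum_level_add_one_eq_of_stationary hPnonneg hProw hlevel hstat) s
  have total : ∑ s : ZMod T, ∑ ω with level ω = s, d ω = 1 := by
    rw [Finset.sum_fiberwise, hdsum]
  simp only [const, Finset.sum_const, Finset.card_univ, ZMod.card, nsmul_eq_mul] at total
  rw [const t, eq_div_iff (NeZero.ne (T : ℝ)), mul_comm, total]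
end

section
/- Let Ω be a nonempty finite type, T ≥ 1 a natural number, P : Ω → Ω → ℝ a row-stochastic matrix, level : Ω → ZMod T a level function for P, and z : Ω a state that is the unique state at its level (every ω with level ω = level z satisfies ω = z). Then every stationary probability distribution d for P satisfies d z = 1/T. -/
/-- The mass that `d` gives to the fibre of `level` over `k`. -/
noncomputable def levelMass {Ω : Type*} [Fintype Ω] {T : ℕ} (level : Ω → ZMod T) (d : Ω → ℝ)
    (k : ZMod T) : ℝ :=
  ∑ ω, if level ω = k then d ω else 0

/-- A stationary measure gives consecutive levels the same mass. -/
theorem levelMass_add_one {Ω : Type*} [Fintype Ω] {T : ℕ} {P : Ω → Ω → ℝ}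
    (hPnonneg : ∀ ω ω', 0 ≤ P ω ω') (hProw : ∀ ω, ∑ ω', P ω ω' = 1)
    {level : Ω → ZMod T} (hlevel : ∀ ω ω', 0 < P ω ω' → level ω' = level ω + 1)
    {d : Ω → ℝ} (hstat : ∀ ω, d ω = ∑ ω', d ω' * P ω' ω) (k : ZMod T) :
    levelMass level d (k + 1) = levelMass level d k := by
  have hP : ∀ ω ω', (if level ω' = k + 1 then d ω * P ω ω' else 0) =
      if level ω = k then d ω * P ω ω' else 0 := by
    intro ω ω'
    rcases (hPnonneg ω ω').eq_or_lt with h | h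
    · simp [← h]
    · simp [hlevel ω ω' h]
  calc levelMass level d (k + 1)
      = ∑ ω', ∑ ω, if level ω' = k + 1 then d ω * P ω ω' else 0 := by
        refine Finset.sum_congr rfl fun ω' _ => ?_
        split_ifs
        · exact hstat ω'
        · simp
    _ = ∑ ω, ∑ ω', if level ω = k then d ω * P ω ω' else 0 := by
        rw [Finset.sum_comm]
        simp only [hP]
    _ = levelMass level d k := by
        refine Finset.sum_congr rfl fun ω _ => ?_
        split_ifs
        · rw [← Finset.mul_sum, hProw, mul_one]
        · simp

theorem stationary_unique_level_state {Ω : Type*} [Fintype Ω] [Nonempty Ω]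
    (T : ℕ) (hT : 1 ≤ T) (P : Ω → Ω → ℝ)
    (hPnonneg : ∀ ω ω', 0 ≤ P ω ω') (hProw : ∀ ω, ∑ ω', P ω ω' = 1)
    (level : Ω → ZMod T)
    (hlevel : ∀ ω ω', 0 < P ω ω' → level ω' = level ω + 1)
    (z : Ω) (hz : ∀ ω, level ω = level z → ω = z)
    (d : Ω → ℝ) (hdnonneg : ∀ ω, 0 ≤ d ω) (hdsum : ∑ ω, d ω = 1)
    (hstat : ∀ ω, d ω = ∑ ω', d ω' * P ω' ω) :
    d z = 1 / (T : ℝ) := by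
  have : NeZero T := ⟨by omega⟩
  have hnat : ∀ n : ℕ, levelMass level d n = levelMass level d 0 := by
    intro n
    induction n with
    | zero => simp
    | succ n ih =>
      rw [Nat.cast_succ, levelMass_add_one hPnonneg hProw hlevel hstat, ih]
  have hconst : ∀ k, levelMass level d k = levelMass level d 0 := by
    intro k
    rw [← ZMod.natCast_zmod_val k, hnat]
  have hsum : ∑ k, levelMass level d k = 1 := by
    unfold levelMass
    rw [Finset.sum_comm]
    simpa using hdsum
  have hmass : levelMass level d (level z) = d z := by
    have hiff : ∀ ω, level ω = level z ↔ ω = z := fun ω => ⟨hz ω, fun h => by rw [h]⟩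
    classical
    simp [levelMass, hiff]
  have hmul : (T : ℝ) * d z = 1 := by
    rw [← hmass, hconst, ← hsum]
    simp [hconst, ZMod.card]
  have hT0 : (T : ℝ) ≠ 0 := NeZero.ne _
  rw [eq_div_iff hT0, mul_comm, hmul]
end

section
/- Let Ω be a nonempty finite type, T ≥ 1 a natural number, P : Ω → Ω → ℝ a row-stochastic matrix, level : Ω → ZMod T a level function for P, and z : Ω a state that is the unique state at its level. Define d : Ω → ℝ by d ω = (1/T) · (P^{m(ω)}) z ω, where m(ω) is the canonical representative in {0, 1, …, T−1} of level ω − level z ∈ ZMod T (i.e., m(ω) = (level ω − level z).val). Then d is a stationary probability distribution for P: d ω ≥ 0 for all ω, Σ_ω d ω = 1, and d ω = Σ_{ω'} d ω' · P ω' ω for every ω. -/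
namespace Matrix

variable {Ω : Type*} [Fintype Ω] [DecidableEq Ω] {P : Matrix Ω Ω ℝ}

lemma pow_apply_nonneg_of_nonneg (hP : ∀ i j, 0 ≤ P i j) (n : ℕ) (i j : Ω) :
    0 ≤ (P ^ n) i j := by
  induction n generalizing j with
  | zero => rw [pow_zero, one_apply]; split_ifs <;> norm_num
  | succ n ih =>
    rw [pow_succ, mul_apply]
    exact Finset.sum_nonneg fun k _ => mul_nonneg (ih k) (hP k j)

lemma sum_row_pow_eq_one (hP : ∀ i, ∑ j, P i j = 1) (n : ℕ) (i : Ω) :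
    ∑ j, (P ^ n) i j = 1 := by
  induction n with
  | zero => simp [one_apply]
  | succ n ih =>
    simp_rw [pow_succ, mul_apply]
    rw [Finset.sum_comm]
    simp_rw [← Finset.mul_sum, hP, mul_one, ih]

lemma level_eq_add_of_pow_apply_ne_zero {T : ℕ} (hP : ∀ i j, 0 ≤ P i j) {level : Ω → ZMod T}
    (hlevel : ∀ i j, 0 < P i j → level j = level i + 1) {n : ℕ} {i j : Ω}
    (h : (P ^ n) i j ≠ 0) : level j = level i + n := by
  induction n generalizing j with
  | zero =>
    obtain rfl : i = j := by
      by_contra hij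
      exact h (by simp [one_apply_ne hij])
    simp
  | succ n ih =>
    rw [pow_succ, mul_apply] at h
    obtain ⟨k, -, hk⟩ := Finset.exists_ne_zero_of_sum_ne_zero h
    rw [hlevel k j ((hP k j).lt_of_ne' (right_ne_zero_of_mul hk)), ih (left_ne_zero_of_mul hk)]
    push_cast
    ring

lemma sum_range_pow_apply_eq_pow_val {T : ℕ} [NeZero T] (hP : ∀ i j, 0 ≤ P i j)
    {level : Ω → ZMod T} (hlevel : ∀ i j, 0 < P i j → level j = level i + 1) (i j : Ω) :
    ∑ n ∈ Finset.range T, (P ^ n) i j = (P ^ (level j - level i).val) i j := by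
  refine Finset.sum_eq_single_of_mem _ (Finset.mem_range.2 (ZMod.val_lt _)) fun n hn hne => ?_
  by_contra h
  refine hne ?_
  rw [level_eq_add_of_pow_apply_ne_zero hP hlevel h, add_sub_cancel_left,
    ZMod.val_cast_of_lt (Finset.mem_range.1 hn)]

lemma pow_period_apply_eq_one_apply {T : ℕ} (hP : ∀ i j, 0 ≤ P i j) (hrow : ∀ i, ∑ j, P i j = 1)
    {level : Ω → ZMod T} (hlevel : ∀ i j, 0 < P i j → level j = level i + 1) {z : Ω}
    (hz : ∀ i, level i = level z → i = z) (j : Ω) :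
    (P ^ T) z j = (1 : Matrix Ω Ω ℝ) z j := by
  have hzero : ∀ k, k ≠ z → (P ^ T) z k = 0 := fun k hk => by
    by_contra h
    exact hk (hz k (by simpa using level_eq_add_of_pow_apply_ne_zero hP hlevel h))
  by_cases hj : j = z
  · rw [hj, one_apply_eq, ← sum_row_pow_eq_one hrow T z]
    exact (Finset.sum_eq_single z (fun k _ hk => hzero k hk) (by simp)).symm
  · rw [hzero j hj, one_apply_ne' hj]

end Matrix

theorem explicit_stationary_exists {Ω : Type*} [Fintype Ω] [Nonempty Ω] [DecidableEq Ω]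
    (T : ℕ) (hT : 1 ≤ T) (P : Matrix Ω Ω ℝ)
    (hPnonneg : ∀ ω ω', 0 ≤ P ω ω') (hProw : ∀ ω, ∑ ω', P ω ω' = 1)
    (level : Ω → ZMod T)
    (hlevel : ∀ ω ω', 0 < P ω ω' → level ω' = level ω + 1)
    (z : Ω) (hz : ∀ ω, level ω = level z → ω = z)
    (d : Ω → ℝ)
    (hd : ∀ ω, d ω = (1 / (T : ℝ)) * (P ^ ((level ω - level z).val)) z ω) :
    (∀ ω, 0 ≤ d ω) ∧ (∑ ω, d ω = 1) ∧ (∀ ω, d ω = ∑ ω', d ω' * P ω' ω) := by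
  have : NeZero T := ⟨by lia⟩
  have hd' : ∀ ω, d ω = 1 / (T : ℝ) * ∑ n ∈ Finset.range T, (P ^ n) z ω := fun ω => by
    rw [hd, Matrix.sum_range_pow_apply_eq_pow_val hPnonneg hlevel]
  refine ⟨fun ω => ?_, ?_, fun ω => ?_⟩
  · rw [hd]
    exact mul_nonneg (by positivity) (Matrix.pow_apply_nonneg_of_nonneg hPnonneg _ _ _)
  · simp_rw [hd', ← Finset.mul_sum]
    rw [Finset.sum_comm]
    simp [Matrix.sum_row_pow_eq_one hProw, NeZero.ne T]
  · have hshift : ∑ ω', (∑ n ∈ Finset.range T, (P ^ n) z ω') * P ω' ω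
        = ∑ n ∈ Finset.range T, (P ^ (n + 1)) z ω := by
      simp_rw [Finset.sum_mul, pow_succ, Matrix.mul_apply]
      exact Finset.sum_comm
    have hperiod := Matrix.pow_period_apply_eq_one_apply hPnonneg hProw hlevel hz ω
    have hsucc := Finset.sum_range_succ (fun n => (P ^ n) z ω) T
    rw [Finset.sum_range_succ', hperiod, pow_zero, add_left_inj] at hsucc
    simp_rw [hd', mul_assoc, ← Finset.mul_sum]
    rw [hshift, hsucc]
end

section
/- Let Ω be a nonempty finite type, T ≥ 1 a natural number, P : Ω → Ω → ℝ a row-stochastic matrix, level : Ω → ZMod T a level function for P, and z : Ω a state that is the unique state at its level. Then every stationary probability distribution d for P is given by the explicit formula d ω = (1/T) · (P^{m(ω)}) z ω for all ω : Ω, where m(ω) = (level ω − level z).val is the canonical representative in {0, 1, …, T−1} of level ω − level z ∈ ZMod T. -/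
open Matrix in
theorem vecMul_pow_eq_self {Ω R : Type*} [Fintype Ω] [DecidableEq Ω] [Semiring R]
    {P : Matrix Ω Ω R} {d : Ω → R} (h : d ᵥ* P = d) (m : ℕ) : d ᵥ* P ^ m = d := by
  induction m with
  | zero => simp
  | succ m ih => rw [pow_succ, ← vecMul_vecMul, ih, h]

theorem level_eq_add_of_pow_apply_ne_zero {Ω R A : Type*} [Fintype Ω] [DecidableEq Ω]
    [Semiring R] [AddMonoidWithOne A] {P : Matrix Ω Ω R} {level : Ω → A}
    (hlevel : ∀ ω ω', P ω ω' ≠ 0 → level ω' = level ω + 1) {m : ℕ} {ω ω' : Ω}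
    (h : (P ^ m) ω ω' ≠ 0) : level ω' = level ω + m := by
  induction m generalizing ω' with
  | zero =>
    by_cases hω : ω = ω'
    · simp [hω]
    · simp [Matrix.one_apply_ne hω] at h
  | succ m ih =>
    rw [pow_succ, Matrix.mul_apply] at h
    obtain ⟨x, -, hx⟩ := Finset.exists_ne_zero_of_sum_ne_zero h
    rw [hlevel x ω' (right_ne_zero_of_mul hx), ih (left_ne_zero_of_mul hx), Nat.cast_succ,
      add_assoc]

theorem stationary_explicit_formula {Ω : Type*} [Fintype Ω] [Nonempty Ω] [DecidableEq Ω]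
    (T : ℕ) (hT : 1 ≤ T) (P : Matrix Ω Ω ℝ)
    (hPnonneg : ∀ ω ω', 0 ≤ P ω ω') (hProw : ∀ ω, ∑ ω', P ω ω' = 1)
    (level : Ω → ZMod T)
    (hlevel : ∀ ω ω', 0 < P ω ω' → level ω' = level ω + 1)
    (z : Ω) (hz : ∀ ω, level ω = level z → ω = z)
    (d : Ω → ℝ) (hdnonneg : ∀ ω, 0 ≤ d ω) (hdsum : ∑ ω, d ω = 1)
    (hstat : ∀ ω, d ω = ∑ ω', d ω' * P ω' ω) :
    ∀ ω, d ω = (1 / (T : ℝ)) * (P ^ ((level ω - level z).val)) z ω := by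
  have : NeZero T := ⟨by omega⟩
  have hstep {m : ℕ} {ω ω' : Ω} (h : (P ^ m) ω ω' ≠ 0) : level ω' = level ω + m :=
    level_eq_add_of_pow_apply_ne_zero
      (fun ω ω' h => hlevel ω ω' (lt_of_le_of_ne (hPnonneg ω ω') h.symm)) h
  have hreturn (ω : Ω) : d ω = d z * (P ^ ((level ω - level z).val)) z ω := by
    conv_lhs => rw [← vecMul_pow_eq_self (funext fun ω => (hstat ω).symm)
      (level ω - level z).val]
    refine Finset.sum_eq_single z (fun x _ hx => ?_) (by simp)
    by_contra h
    have hl := hstep (right_ne_zero_of_mul h)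
    rw [ZMod.natCast_zmod_val] at hl
    exact hx (hz x (by linear_combination -hl))
  have hcycle (ω : Ω) :
      (P ^ ((level ω - level z).val)) z ω = ∑ k ∈ Finset.range T, (P ^ k) z ω := by
    symm
    refine Finset.sum_eq_single _ (fun k hk hne => ?_) (fun h => ?_)
    · by_contra h
      apply hne
      rw [hstep h, add_sub_cancel_left, ZMod.val_cast_of_lt (Finset.mem_range.mp hk)]
    · exact absurd (Finset.mem_range.mpr (ZMod.val_lt _)) h
  have hrow (k : ℕ) : ∑ ω, (P ^ k) z ω = 1 :=
    Matrix.sum_row_of_mem_rowStochastic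
      (pow_mem (Matrix.mem_rowStochastic_iff_sum.mpr ⟨hPnonneg, hProw⟩) k) z
  have hdz : d z * T = 1 := by
    rw [← hdsum, Finset.sum_congr rfl fun ω _ => hreturn ω, ← Finset.mul_sum,
      Finset.sum_congr rfl fun ω _ => hcycle ω, Finset.sum_comm]
    simp [hrow]
  intro ω
  rw [hreturn ω, eq_one_div_of_mul_eq_one_left hdz]
end

section
/- Let Ω be a nonempty finite type, T ≥ 1 a natural number, P : Ω → Ω → ℝ a row-stochastic matrix, level : Ω → ZMod T a level function for P, and z : Ω a state that is the unique state at its level. Then P has a unique stationary probability distribution: if d₁ and d₂ are both stationary probability distributions for P, then d₁ = d₂. -/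
theorem ite_level_eq_succ {Ω : Type*} {T : ℕ} {P : Ω → Ω → ℝ} {level : Ω → ZMod T}
    (hP : ∀ ω ω', 0 ≤ P ω ω')
    (hlevel : ∀ ω ω', 0 < P ω ω' → level ω' = level ω + 1) (k : ZMod T) (ω ω' : Ω) :
    (if level ω' = k + 1 then P ω ω' else 0) = if level ω = k then P ω ω' else 0 := by
  rcases (hP ω ω').eq_or_lt with h | h
  · simp [← h]
  · simp [hlevel ω ω' h]

/-- The total mass of an invariant signed vector is the same at consecutive levels. -/
theorem levelMass_succ {Ω : Type*} [Fintype Ω] {T : ℕ} {P : Ω → Ω → ℝ} {level : Ω → ZMod T}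
    (hP : ∀ ω ω', 0 ≤ P ω ω') (hProw : ∀ ω, ∑ ω', P ω ω' = 1)
    (hlevel : ∀ ω ω', 0 < P ω ω' → level ω' = level ω + 1)
    {e : Ω → ℝ} (he : ∀ ω, e ω = ∑ ω', e ω' * P ω' ω) (k : ZMod T) :
    ∑ ω, (if level ω = k + 1 then e ω else 0) = ∑ ω, if level ω = k then e ω else 0 := by
  calc ∑ ω, (if level ω = k + 1 then e ω else 0)
      = ∑ ω, ∑ ω', e ω' * (if level ω = k + 1 then P ω' ω else 0) := by
        refine Finset.sum_congr rfl fun ω _ => ?_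
        split_ifs
        · exact he ω
        · simp
    _ = ∑ ω', ∑ ω, e ω' * (if level ω' = k then P ω' ω else 0) := by
        rw [Finset.sum_comm]
        simp_rw [ite_level_eq_succ hP hlevel]
    _ = ∑ ω, if level ω = k then e ω else 0 := by
        refine Finset.sum_congr rfl fun ω _ => ?_
        split_ifs
        · rw [← Finset.mul_sum, hProw, mul_one]
        · simp

/-- An invariant signed vector of total mass zero vanishes. -/
theorem eq_zero_of_invariant_of_sum_eq_zero {Ω : Type*} [Fintype Ω] {T : ℕ} [NeZero T]
    {P : Ω → Ω → ℝ} {level : Ω → ZMod T}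
    (hP : ∀ ω ω', 0 ≤ P ω ω') (hProw : ∀ ω, ∑ ω', P ω ω' = 1)
    (hlevel : ∀ ω ω', 0 < P ω ω' → level ω' = level ω + 1)
    {z : Ω} (hz : ∀ ω, level ω = level z → ω = z)
    {e : Ω → ℝ} (he : ∀ ω, e ω = ∑ ω', e ω' * P ω' ω) (hsum : ∑ ω, e ω = 0) (ω : Ω) :
    e ω = 0 := by
  have hmass_z : ∑ ω, (if level ω = level z then e ω else 0) = e z := by
    rw [Finset.sum_eq_single z (fun ω _ hne => if_neg fun h => hne (hz ω h)) (by simp)]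
    simp
  have exists_nat (k : ZMod T) : ∃ n : ℕ, k = level z + n :=
    ⟨(k - level z).val, by simp⟩
  have hmass (k : ZMod T) : ∑ ω, (if level ω = k then e ω else 0) = e z := by
    obtain ⟨n, rfl⟩ := exists_nat k
    induction n with
    | zero => simpa using hmass_z
    | succ n ih =>
      rw [Nat.cast_succ, ← add_assoc, levelMass_succ hP hProw hlevel he, ih]
  have hez : e z = 0 := by
    have htotal : ∑ k : ZMod T, ∑ ω, (if level ω = k then e ω else 0) = 0 := by
      rw [Finset.sum_comm]
      simpa using hsum
    simpa [hmass, NeZero.ne T] using htotal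
  have hzero (n : ℕ) : ∀ ω, level ω = level z + n → e ω = 0 := by
    induction n with
    | zero =>
      intro ω h
      rw [hz ω (by simpa using h), hez]
    | succ n ih =>
      intro ω h
      rw [he ω]
      refine Finset.sum_eq_zero fun ω' _ => ?_
      rcases (hP ω' ω).eq_or_lt with h0 | h0
      · rw [← h0, mul_zero]
      · have hstep := hlevel ω' ω h0
        rw [h, Nat.cast_succ, ← add_assoc] at hstep
        rw [ih ω' (add_right_cancel hstep).symm, zero_mul]
  obtain ⟨n, hn⟩ := exists_nat (level ω)
  exact hzero n ω hn

theorem stationary_unique {Ω : Type*} [Fintype Ω] [Nonempty Ω]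
    (T : ℕ) (hT : 1 ≤ T) (P : Ω → Ω → ℝ)
    (hPnonneg : ∀ ω ω', 0 ≤ P ω ω') (hProw : ∀ ω, ∑ ω', P ω ω' = 1)
    (level : Ω → ZMod T)
    (hlevel : ∀ ω ω', 0 < P ω ω' → level ω' = level ω + 1)
    (z : Ω) (hz : ∀ ω, level ω = level z → ω = z)
    (d₁ d₂ : Ω → ℝ)
    (hd₁nonneg : ∀ ω, 0 ≤ d₁ ω) (hd₁sum : ∑ ω, d₁ ω = 1)
    (hd₁stat : ∀ ω, d₁ ω = ∑ ω', d₁ ω' * P ω' ω)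
    (hd₂nonneg : ∀ ω, 0 ≤ d₂ ω) (hd₂sum : ∑ ω, d₂ ω = 1)
    (hd₂stat : ∀ ω, d₂ ω = ∑ ω', d₂ ω' * P ω' ω) :
    d₁ = d₂ := by
  have : NeZero T := ⟨by omega⟩
  funext ω
  refine sub_eq_zero.mp (eq_zero_of_invariant_of_sum_eq_zero (e := fun ω => d₁ ω - d₂ ω)
    hPnonneg hProw hlevel hz (fun ω => ?_) ?_ ω)
  · simp only [sub_mul, Finset.sum_sub_distrib]
    rw [← hd₁stat, ← hd₂stat]
  · rw [Finset.sum_sub_distrib, hd₁sum, hd₂sum, sub_self]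
end

section
/- Let Ω be a nonempty finite type, T ≥ 1 a natural number, P : Ω → Ω → ℝ a row-stochastic matrix, level : Ω → ZMod T a level function for P, z : Ω a state that is the unique state at its level, and d a stationary probability distribution for P. Then for every reward function R : Ω → ℝ, Σ_ω d ω · R ω = (1/T) · Σ_{m=1}^{T} Σ_ω (P^m) z ω · R ω; that is, the expected reward under the stationary distribution equals 1/T times the total expected reward accumulated over the T steps following the state z. -/
namespace Matrix

variable {Ω : Type*} [Fintype Ω] [DecidableEq Ω]

theorem level_eq_add_of_pow_apply_ne_zero_s8 {G : Type*} [AddGroupWithOne G] {P : Matrix Ω Ω ℝ}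
    {level : Ω → G} (hlevel : ∀ ω ω', P ω ω' ≠ 0 → level ω' = level ω + 1) (m : ℕ) {ω ω' : Ω}
    (h : (P ^ m) ω ω' ≠ 0) : level ω' = level ω + m := by
  induction m generalizing ω' with
  | zero =>
    rw [pow_zero] at h
    have : ω = ω' := by
      by_contra hne
      exact h (one_apply_ne hne)
    simp [this]
  | succ m ih =>
    rw [pow_succ, mul_apply] at h
    obtain ⟨η, -, hη⟩ := Finset.exists_ne_zero_of_sum_ne_zero h
    rw [hlevel η ω' (right_ne_zero_of_mul hη), ih (left_ne_zero_of_mul hη), Nat.cast_succ,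
      add_assoc]

theorem vecMul_pow_eq_self {P : Matrix Ω Ω ℝ} {d : Ω → ℝ} (h : d ᵥ* P = d) (m : ℕ) :
    d ᵥ* P ^ m = d := by
  induction m with
  | zero => simp
  | succ m ih => rw [pow_succ, ← vecMul_vecMul, ih, h]

theorem pow_mulVec_eq_self {P : Matrix Ω Ω ℝ} {v : Ω → ℝ} (h : P *ᵥ v = v) (m : ℕ) :
    P ^ m *ᵥ v = v := by
  induction m with
  | zero => simp
  | succ m ih => rw [pow_succ, ← mulVec_mulVec, h, ih]

end Matrix

theorem ZMod.exists_mem_Icc_natCast_eq {T : ℕ} (hT : 1 ≤ T) (x : ZMod T) :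
    ∃ m ∈ Finset.Icc 1 T, (m : ZMod T) = x := by
  have : NeZero T := ⟨by omega⟩
  refine ⟨(x - 1).val + 1, ?_, by simp⟩
  have := ZMod.val_lt (x - 1)
  simp only [Finset.mem_Icc]
  omega

theorem ZMod.natCast_injOn_Icc (T : ℕ) :
    Set.InjOn (fun m : ℕ => (m : ZMod T)) (Finset.Icc 1 T) := by
  intro a ha b hb h
  simp only [Finset.coe_Icc, Set.mem_Icc] at ha hb
  obtain ⟨a, rfl⟩ := Nat.exists_eq_add_of_le' ha.1
  obtain ⟨b, rfl⟩ := Nat.exists_eq_add_of_le' hb.1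
  have hab : a ≡ b [MOD T] :=
    Nat.ModEq.add_right_cancel' 1 ((ZMod.natCast_eq_natCast_iff _ _ _).1 h)
  rw [hab.eq_of_lt_of_lt (by omega) (by omega)]

/-- A stationary vector is proportional to the expected visit counts over one cycle started at
the unique state of a level. -/
theorem Matrix.stationary_apply_eq_mul_sum_pow {Ω : Type*} [Fintype Ω] [DecidableEq Ω]
    {T : ℕ} (hT : 1 ≤ T) {P : Matrix Ω Ω ℝ} {level : Ω → ZMod T}
    (hlevel : ∀ ω ω', P ω ω' ≠ 0 → level ω' = level ω + 1)
    {z : Ω} (hz : ∀ ω, level ω = level z → ω = z) {d : Ω → ℝ} (hd : vecMul d P = d) (ω : Ω) :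
    d ω = d z * ∑ m ∈ Finset.Icc 1 T, (P ^ m) z ω := by
  obtain ⟨m, hm, hmω⟩ := ZMod.exists_mem_Icc_natCast_eq hT (level ω - level z)
  have hsum : ∑ k ∈ Finset.Icc 1 T, (P ^ k) z ω = (P ^ m) z ω := by
    refine Finset.sum_eq_single_of_mem m hm fun k hk hkm => ?_
    by_contra hne
    have hkω := level_eq_add_of_pow_apply_ne_zero_s8 hlevel k hne
    exact hkm (ZMod.natCast_injOn_Icc T hk hm (by simp [hmω, hkω]))
  rw [hsum]
  conv_lhs => rw [← vecMul_pow_eq_self hd m]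
  refine Finset.sum_eq_single_of_mem z (Finset.mem_univ z) fun η _ hηz => ?_
  by_contra hne
  have hη := level_eq_add_of_pow_apply_ne_zero_s8 hlevel m (right_ne_zero_of_mul hne)
  exact hηz (hz η (add_right_cancel (b := (m : ZMod T)) (by rw [← hη, hmω]; abel)))

theorem stationary_reward_identity {Ω : Type*} [Fintype Ω] [Nonempty Ω] [DecidableEq Ω]
    (T : ℕ) (hT : 1 ≤ T) (P : Matrix Ω Ω ℝ)
    (hPnonneg : ∀ ω ω', 0 ≤ P ω ω') (hProw : ∀ ω, ∑ ω', P ω ω' = 1)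
    (level : Ω → ZMod T)
    (hlevel : ∀ ω ω', 0 < P ω ω' → level ω' = level ω + 1)
    (z : Ω) (hz : ∀ ω, level ω = level z → ω = z)
    (d : Ω → ℝ) (hdnonneg : ∀ ω, 0 ≤ d ω) (hdsum : ∑ ω, d ω = 1)
    (hstat : ∀ ω, d ω = ∑ ω', d ω' * P ω' ω) :
    ∀ R : Ω → ℝ,
      ∑ ω, d ω * R ω
        = (1 / (T : ℝ)) * ∑ m ∈ Finset.Icc 1 T, ∑ ω, (P ^ m) z ω * R ω := by
  intro R
  have hd : Matrix.vecMul d P = d := funext fun ω => (hstat ω).symm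
  have hrow : P.mulVec 1 = 1 := funext fun ω => by simp [Matrix.mulVec, dotProduct, hProw]
  have key := Matrix.stationary_apply_eq_mul_sum_pow hT
    (fun ω ω' h => hlevel ω ω' ((hPnonneg ω ω').lt_of_ne' h)) hz hd
  have hvisits (f : Ω → ℝ) :
      ∑ ω, d ω * f ω = d z * ∑ m ∈ Finset.Icc 1 T, ∑ ω, (P ^ m) z ω * f ω := by
    rw [Finset.sum_comm, Finset.mul_sum]
    refine Finset.sum_congr rfl fun ω _ => ?_
    rw [key ω, mul_assoc, Finset.sum_mul]
  have hpow (m : ℕ) : ∑ ω, (P ^ m) z ω = 1 := by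
    simpa [Matrix.mulVec, dotProduct] using congrFun (Matrix.pow_mulVec_eq_self hrow m) z
  have hdz : 1 = d z * T := by simpa [hdsum, hpow] using hvisits 1
  rw [hvisits R, eq_one_div_of_mul_eq_one_left hdz.symm]
end

section
/- Let S and A be nonempty finite types and T ≥ 1 a natural number. Let P : S → A → S → ℝ be a transition kernel with P s a s' ≥ 0 and Σ_{s'} P s a s' = 1 for all s, a, and let π : S → A → ℝ be a policy with π s a ≥ 0 and Σ_a π s a = 1 for all s. Define the state-action kernel K : (S × A) → (S × A) → ℝ by K (s,a) (s',a') = P s a s' · π s' a'. Suppose ℓ : S × A → ZMod T satisfies K (s,a) (s',a') > 0 → ℓ (s',a') = ℓ (s,a) + 1, and z : S × A is such that every (s,a) with ℓ (s,a) = ℓ z satisfies (s,a) = z. Then: (i) there exists exactly one probability distribution d : S × A → ℝ (d ≥ 0, Σ d = 1) satisfying the stationarity equation d (s,a) = Σ_{(s',a')} d (s',a') · P s' a' s · π s a for all (s,a); and (ii) for every reward function R : S × A → ℝ, Σ_{(s,a)} d (s,a) · R (s,a) = (1/T) · Σ_{m=1}^{T} Σ_{(s,a)} (K^m) z (s,a)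 · R (s,a). -/
theorem sum_range_add_eq_of_periodic {f : ℕ → ℝ} {T : ℕ} (hf : ∀ n, f (n + T) = f n) (n : ℕ) :
    ∑ i ∈ Finset.range T, f (n + i) = ∑ i ∈ Finset.range T, f i := by
  induction n with
  | zero => simp
  | succ n ih =>
    rw [← ih]
    have h₁ := Finset.sum_range_succ (fun i => f (n + i)) T
    have h₂ := Finset.sum_range_succ' (fun i => f (n + i)) T
    have h₃ : ∑ i ∈ Finset.range T, f (n + 1 + i) = ∑ i ∈ Finset.range T, f (n + (i + 1)) :=
      Finset.sum_congr rfl fun i _ => by rw [add_assoc, add_comm 1 i]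
    simp only [add_zero, hf] at h₁ h₂
    linarith

namespace Matrix

variable {X : Type*} [Fintype X] [DecidableEq X] {K : Matrix X X ℝ}

theorem pow_nonneg_of_nonneg (hK : ∀ x y, 0 ≤ K x y) (n : ℕ) (x y : X) : 0 ≤ (K ^ n) x y := by
  induction n generalizing y with
  | zero => rw [pow_zero, one_apply]; split_ifs <;> norm_num
  | succ n ih =>
    rw [pow_succ, mul_apply]
    exact Finset.sum_nonneg fun w _ => mul_nonneg (ih w) (hK w y)

theorem sum_pow_eq_one_of_sum_eq_one (hK : ∀ x, ∑ y, K x y = 1) (n : ℕ) (x : X) :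
    ∑ y, (K ^ n) x y = 1 := by
  induction n with
  | zero => simp [one_apply]
  | succ n ih =>
    simp only [pow_succ, mul_apply]
    rw [Finset.sum_comm]
    simp [← Finset.mul_sum, hK, ih]

theorem level_eq_of_pow_ne_zero {T : ℕ} {l : X → ZMod T}
    (hl : ∀ x y, K x y ≠ 0 → l y = l x + 1) {n : ℕ} {x y : X} (h : (K ^ n) x y ≠ 0) :
    l y = l x + n := by
  induction n generalizing y with
  | zero =>
    rw [pow_zero, one_apply] at h
    obtain rfl : x = y := by by_contra hne; simp [hne] at h
    simp
  | succ n ih =>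
    rw [pow_succ, mul_apply] at h
    obtain ⟨w, -, hw⟩ := Finset.exists_ne_zero_of_sum_ne_zero h
    rw [hl w y (right_ne_zero_of_mul hw), ih (left_ne_zero_of_mul hw)]
    push_cast
    ring

/-- If the chain started at `x` sits at the unique state `z` of its level after `k` steps, then it
continues from there as the chain started at `z`. -/
theorem pow_add_apply_of_level_eq (hrow : ∀ x, ∑ y, K x y = 1) {T : ℕ} {l : X → ZMod T}
    (hl : ∀ x y, K x y ≠ 0 → l y = l x + 1) {z : X} (hz : ∀ x, l x = l z → x = z)
    {k : ℕ} {x : X} (hk : l x + k = l z) (n : ℕ) (y : X) :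
    (K ^ (k + n)) x y = (K ^ n) z y := by
  have h0 : ∀ w, w ≠ z → (K ^ k) x w = 0 := fun w hw => by
    by_contra h
    exact hw (hz w ((level_eq_of_pow_ne_zero hl h).trans hk))
  have h1 : (K ^ k) x z = 1 := by
    rw [← sum_pow_eq_one_of_sum_eq_one hrow k x]
    exact (Finset.sum_eq_single z (fun w _ hw => h0 w hw) (by simp)).symm
  rw [pow_add, mul_apply, Finset.sum_eq_single z (fun w _ hw => by rw [h0 w hw, zero_mul])
    (by simp), h1, one_mul]

theorem sum_mul_pow_of_stationary {d : X → ℝ} (hd : ∀ y, d y = ∑ x, d x * K x y) (n : ℕ) (y : X) :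
    ∑ x, d x * (K ^ n) x y = d y := by
  have h : d ᵥ* K = d := funext fun y => (hd y).symm
  have hn : d ᵥ* K ^ n = d := by
    induction n with
    | zero => simp
    | succ n ih => rw [pow_succ, ← vecMul_vecMul, ih, h]
  exact congrFun hn y

/-- A stationary distribution of a periodic chain is the average over one cycle started at the
unique state of its level. -/
theorem stationary_eq_cycle_average (hrow : ∀ x, ∑ y, K x y = 1) {T : ℕ} (hT : 1 ≤ T)
    {l : X → ZMod T} (hl : ∀ x y, K x y ≠ 0 → l y = l x + 1) {z : X}
    (hz : ∀ x, l x = l z → x = z) {d : X → ℝ} (hsum : ∑ x, d x = 1)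
    (hd : ∀ y, d y = ∑ x, d x * K x y) (y : X) :
    d y = (1 / (T : ℝ)) * ∑ i ∈ Finset.range T, (K ^ (i + 1)) z y := by
  have : NeZero T := ⟨by omega⟩
  have hper : ∀ n, (K ^ (n + T + 1)) z y = (K ^ (n + 1)) z y := fun n => by
    rw [show n + T + 1 = T + (n + 1) by ring]
    exact pow_add_apply_of_level_eq hrow hl hz (by simp) _ _
  have hcycle : ∀ x, ∑ i ∈ Finset.range T, (K ^ (T + i + 1)) x y
      = ∑ i ∈ Finset.range T, (K ^ (i + 1)) z y := fun x => by
    have hk : (l z - l x).val ≤ T := (ZMod.val_lt _).le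
    rw [← sum_range_add_eq_of_periodic (f := fun n => (K ^ (n + 1)) z y) hper
      (T - (l z - l x).val)]
    refine Finset.sum_congr rfl fun i _ => ?_
    rw [show T + i + 1 = (l z - l x).val + (T - (l z - l x).val + i + 1) by omega]
    exact pow_add_apply_of_level_eq hrow hl hz (by simp) _ _
  have hmain : (T : ℝ) * d y = ∑ i ∈ Finset.range T, (K ^ (i + 1)) z y := by
    calc (T : ℝ) * d y = ∑ i ∈ Finset.range T, ∑ x, d x * (K ^ (T + i + 1)) x y := by
          simp [sum_mul_pow_of_stationary hd]
      _ = ∑ x, d x * ∑ i ∈ Finset.range T, (K ^ (T + i + 1)) x y := by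
          rw [Finset.sum_comm]; simp only [Finset.mul_sum]
      _ = _ := by simp only [hcycle]; rw [← Finset.sum_mul, hsum, one_mul]
  have hT0 : (T : ℝ) ≠ 0 := NeZero.ne _
  rw [← hmain]
  field_simp

theorem cycle_average_stationary (hrow : ∀ x, ∑ y, K x y = 1) {T : ℕ}
    {l : X → ZMod T} (hl : ∀ x y, K x y ≠ 0 → l y = l x + 1) {z : X}
    (hz : ∀ x, l x = l z → x = z) (y : X) :
    (1 / (T : ℝ)) * ∑ i ∈ Finset.range T, (K ^ (i + 1)) z y
      = ∑ x, ((1 / (T : ℝ)) * ∑ i ∈ Finset.range T, (K ^ (i + 1)) z x) * K x y := by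
  have hper : ∀ n, (K ^ (n + T + 1)) z y = (K ^ (n + 1)) z y := fun n => by
    rw [show n + T + 1 = T + (n + 1) by ring]
    exact pow_add_apply_of_level_eq hrow hl hz (by simp) _ _
  rw [← sum_range_add_eq_of_periodic (f := fun n => (K ^ (n + 1)) z y) hper 1]
  simp only [mul_assoc, ← Finset.mul_sum, Finset.sum_mul]
  rw [Finset.sum_comm]
  congr 1
  refine Finset.sum_congr rfl fun i _ => ?_
  rw [show 1 + i + 1 = (i + 1) + 1 by ring, pow_succ, mul_apply]

end Matrix


theorem enigma_theorem_one {S A : Type*} [Fintype S] [Nonempty S] [Fintype A] [Nonempty A]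
    [DecidableEq S] [DecidableEq A]
    (T : ℕ) (hT : 1 ≤ T)
    (P : S → A → S → ℝ)
    (hPnonneg : ∀ s a s', 0 ≤ P s a s') (hProw : ∀ s a, ∑ s', P s a s' = 1)
    (π : S → A → ℝ)
    (hπnonneg : ∀ s a, 0 ≤ π s a) (hπrow : ∀ s, ∑ a, π s a = 1)
    (K : Matrix (S × A) (S × A) ℝ)
    (hK : ∀ s a s' a', K (s, a) (s', a') = P s a s' * π s' a')
    (ℓ : S × A → ZMod T)
    (hℓ : ∀ x y : S × A, 0 < K x y → ℓ y = ℓ x + 1)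
    (z : S × A) (hz : ∀ x : S × A, ℓ x = ℓ z → x = z) :
    (∃! d : S × A → ℝ,
        (∀ x, 0 ≤ d x) ∧ (∑ x, d x = 1) ∧
        (∀ s a, d (s, a) = ∑ x : S × A, d x * P x.1 x.2 s * π s a)) ∧
    (∀ d : S × A → ℝ,
        ((∀ x, 0 ≤ d x) ∧ (∑ x, d x = 1) ∧
          (∀ s a, d (s, a) = ∑ x : S × A, d x * P x.1 x.2 s * π s a)) →
        ∀ R : S × A → ℝ,
          ∑ x, d x * R x
            = (1 / (T : ℝ)) * ∑ m ∈ Finset.Icc 1 T, ∑ x, (K ^ m) z x * R x) := by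
  have hnonneg : ∀ x y, 0 ≤ K x y := fun x y => by
    rw [hK x.1 x.2 y.1 y.2]
    exact mul_nonneg (hPnonneg _ _ _) (hπnonneg _ _)
  have hrow : ∀ x, ∑ y, K x y = 1 := fun x => by
    simp [Fintype.sum_prod_type, hK x.1 x.2, ← Finset.mul_sum, hπrow, hProw]
  have hl : ∀ x y, K x y ≠ 0 → ℓ y = ℓ x + 1 := fun x y h =>
    hℓ x y (lt_of_le_of_ne (hnonneg x y) h.symm)
  have hstat : ∀ d : S × A → ℝ, (∀ s a, d (s, a) = ∑ x : S × A, d x * P x.1 x.2 s * π s a) ↔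
      ∀ y, d y = ∑ x, d x * K x y := fun d => by
    rw [Prod.forall]
    refine forall_congr' fun s => forall_congr' fun a => ?_
    simp only [mul_assoc]
    rw [Finset.sum_congr rfl fun x _ => by rw [← hK x.1 x.2 s a]]
  have hT0 : (T : ℝ) ≠ 0 := Nat.cast_ne_zero.mpr (by omega)
  simp only [hstat]
  refine ⟨⟨fun y => (1 / (T : ℝ)) * ∑ i ∈ Finset.range T, (K ^ (i + 1)) z y,
    ⟨fun y => ?_, ?_, Matrix.cycle_average_stationary hrow hl hz⟩, ?_⟩, ?_⟩
  · exact mul_nonneg (by positivity)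
      (Finset.sum_nonneg fun i _ => Matrix.pow_nonneg_of_nonneg hnonneg _ _ _)
  · rw [← Finset.mul_sum, Finset.sum_comm]
    simp [Matrix.sum_pow_eq_one_of_sum_eq_one hrow, hT0]
  · rintro d ⟨-, hsum, hd⟩
    exact funext (Matrix.stationary_eq_cycle_average hrow hT hl hz hsum hd)
  · rintro d ⟨-, hsum, hd⟩ R
    simp only [Matrix.stationary_eq_cycle_average hrow hT hl hz hsum hd, mul_assoc,
      ← Finset.mul_sum, Finset.sum_mul]
    rw [Finset.sum_comm, Finset.range_eq_Ico,
      Finset.sum_Ico_add' (fun m => ∑ x, (K ^ m) z x * R x) 0 T 1]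
    rfl
end
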